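/- The region D = { d ∈ ℝ^4 : d ≥ 0, d_1+d_2+d_3 ≤ 1, d_1+d_2+d_4 ≤ 1, d_2+d_3+d_4 ≤ 1, d_1+d_3+d_4 ≤ 1 } equals the convex hull of the six points 0, e_1, e_2, e_3, e_4, and (1/3,1/3,1/3,1/3), where e_i denotes the i-th standard basis vector of ℝ^4. -/

import Mathlib

/-- A vector whose entries are bounded below by some `m ≥ 0` and sum to at most `1 + m` is a convex
combination of `0`, the standard basis vectors and the constant vector `1/3`. -/
theorem mem_convexHull_of_le_of_sum_le {d : Fin 4 → ℝ} {m : ℝ} (hm : 0 ≤ m) (hd : ∀ k, m ≤ d k)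
    (hsum : d 0 + d 1 + d 2 + d 3 ≤ 1 + m) :
    d ∈ convexHull ℝ
      {(0 : Fin 4 → ℝ),
       Pi.single 0 1, Pi.single 1 1, Pi.single 2 1, Pi.single 3 1,
       fun _ => (1 : ℝ)/3} := by
  let w : Fin 6 → ℝ :=
    ![1 + m - (d 0 + d 1 + d 2 + d 3), d 0 - m, d 1 - m, d 2 - m, d 3 - m, 3 * m]
  let z : Fin 6 → Fin 4 → ℝ :=
    ![0, Pi.single 0 1, Pi.single 1 1, Pi.single 2 1, Pi.single 3 1, fun _ => (1 : ℝ)/3]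
  have hw : ∀ i ∈ Finset.univ, 0 ≤ w i := by
    intro i _
    have := hd 0
    have := hd 1
    have := hd 2
    have := hd 3
    fin_cases i <;> simp [w] <;> linarith
  have hw_sum : ∑ i, w i = 1 := by
    simp [w, Fin.sum_univ_succ]
    ring
  have hz : ∀ i ∈ Finset.univ, z i ∈ convexHull ℝ
      {(0 : Fin 4 → ℝ),
       Pi.single 0 1, Pi.single 1 1, Pi.single 2 1, Pi.single 3 1,
       fun _ => (1 : ℝ)/3} := by
    intro i _
    apply subset_convexHull
    fin_cases i <;> simp [z]
  have hd_eq : ∑ i, w i • z i = d := by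
    ext k
    fin_cases k <;> simp [w, z, Fin.sum_univ_six] <;> ring
  exact hd_eq ▸ (convex_convexHull ℝ _).sum_mem hw hw_sum hz

/-- The example region in ℝ^4 equals the convex hull of
0, e_1, e_2, e_3, e_4, and (1/3,1/3,1/3,1/3). -/
theorem stmt_2 :
    {d : Fin 4 → ℝ |
      (∀ k, 0 ≤ d k) ∧
      d 0 + d 1 + d 2 ≤ 1 ∧
      d 0 + d 1 + d 3 ≤ 1 ∧
      d 1 + d 2 + d 3 ≤ 1 ∧
      d 0 + d 2 + d 3 ≤ 1} =
    convexHull ℝ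
      {(0 : Fin 4 → ℝ),
       Pi.single 0 1, Pi.single 1 1, Pi.single 2 1, Pi.single 3 1,
       fun _ => (1 : ℝ)/3} := by
  apply Set.Subset.antisymm
  · rintro d ⟨hd, h₁, h₂, h₃, h₄⟩
    obtain ⟨j, hj⟩ := Finite.exists_min d
    refine mem_convexHull_of_le_of_sum_le (hd j) hj ?_
    fin_cases j <;> simp <;> linarith
  · apply convexHull_min
    · rintro d (rfl | rfl | rfl | rfl | rfl | rfl) <;>
        (simp [Fin.forall_fin_succ]; try norm_num)
    · rintro x ⟨hx, hx₁, hx₂, hx₃, hx₄⟩ y ⟨hy, hy₁, hy₂, hy₃, hy₄⟩ a b ha hb hab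
      simp only [Set.mem_ofPred_eq, Pi.add_apply, Pi.smul_apply, smul_eq_mul]
      refine ⟨fun k => ?_, ?_, ?_, ?_, ?_⟩
      · have := hx k
        have := hy k
        positivity
      all_goals nlinarith
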